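/- Let A be a nonsingular n×n matrix over a field, and let I, J be subsets of the row and column index sets with |I| = |J| = r, with complements Iᶜ, Jᶜ. Then det(A_{I,J}) = ε · det(A) · det(((Aᵀ)⁻¹)_{Iᶜ,Jᶜ}), where ε = (−1)^{Σ_{i∈I} i + Σ_{j∈J} j} (in particular det(A_{I,J}) = ± det(A) · det(((Aᵀ)⁻¹)_{Iᶜ,Jᶜ})). -/

import Mathlib

open Matrix

/-- Transposing two adjacent elements preserves the order of any set not containing both. -/
lemma strictMonoOn_swap_of_val_eq_succ {n : ℕ} {a b : Fin n} (hab : (b : ℕ) = a + 1)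
    {s : Set (Fin n)} (hs : ¬ (a ∈ s ∧ b ∈ s)) : StrictMonoOn (Equiv.swap a b) s := by
  intro x hx y hy hxy
  rw [Equiv.swap_apply_def, Equiv.swap_apply_def]
  have hxy' : ¬ (x = a ∧ y = b) := by
    rintro ⟨rfl, rfl⟩
    exact hs ⟨hx, hy⟩
  split_ifs <;> simp only [Fin.ext_iff, Fin.lt_def] at * <;> omega

lemma orderEmbOfFin_map_swap {n r : ℕ} {a b : Fin n} (hab : (b : ℕ) = a + 1)
    {s t : Finset (Fin n)} (hs : ¬ (a ∈ s ∧ b ∈ s)) (hsr : s.card = r) (htr : t.card = r)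
    (ht : ∀ x ∈ s, Equiv.swap a b x ∈ t) (k : Fin r) :
    t.orderEmbOfFin htr k = Equiv.swap a b (s.orderEmbOfFin hsr k) := by
  refine (congrFun (Finset.orderEmbOfFin_unique htr
    (f := fun k => Equiv.swap a b (s.orderEmbOfFin hsr k)) (fun k => ht _ (by simp)) ?_) k).symm
  intro x y hxy
  exact strictMonoOn_swap_of_val_eq_succ hab (s := s) (by simpa using hs) (by simp) (by simp)
    ((s.orderEmbOfFin hsr).strictMono hxy)

lemma finSumEquivOfFinset_map_swap {n r m : ℕ} {a b : Fin n} (hab : (b : ℕ) = a + 1)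
    {s : Finset (Fin n)} (ha : a ∉ s) (hb : b ∈ s) (hs : s.card = r) (hsc : sᶜ.card = m)
    (ht : (s.map (Equiv.swap a b).toEmbedding).card = r)
    (htc : (s.map (Equiv.swap a b).toEmbedding)ᶜ.card = m) :
    finSumEquivOfFinset ht htc = (finSumEquivOfFinset hs hsc).trans (Equiv.swap a b) := by
  ext1 k
  rcases k with k | k
  · simp only [Equiv.trans_apply, finSumEquivOfFinset_inl]
    exact orderEmbOfFin_map_swap hab (by simp [ha]) hs ht (by simp) k
  · simp only [Equiv.trans_apply, finSumEquivOfFinset_inr]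
    exact orderEmbOfFin_map_swap hab (by simp [hb]) hsc htc (by simp) k

lemma exists_isLowerSet_sign_finSumEquivOfFinset {n r m : ℕ} (s : Finset (Fin n))
    (hs : s.card = r) (hsc : sᶜ.card = m) :
    ∃ (t : Finset (Fin n)) (ht : t.card = r) (htc : tᶜ.card = m), IsLowerSet (t : Set (Fin n)) ∧
      Equiv.Perm.sign ((finSumEquivOfFinset hs hsc).symm.trans (finSumEquivOfFinset ht htc)) =
        (-1) ^ ((∑ i ∈ s, (i : ℕ)) + ∑ i ∈ t, (i : ℕ)) := by
  induction hk : ∑ i ∈ s, (i : ℕ) using Nat.strong_induction_on generalizing s with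
  | _ k ih =>
  by_cases hl : ∀ a b : Fin n, (b : ℕ) = a + 1 → b ∈ s → a ∈ s
  · refine ⟨s, hs, hsc, ?_, by simp [hk, ← two_mul]⟩
    intro b a hab hb
    obtain ⟨a, ha⟩ := a
    obtain ⟨b, hb'⟩ := b
    simp only [Fin.mk_le_mk] at hab
    induction b, hab using Nat.le_induction with
    | base => exact hb
    | succ c hc h => exact h (by omega) (hl ⟨c, by omega⟩ ⟨c + 1, hb'⟩ rfl hb)
  · push Not at hl
    obtain ⟨a, b, hab, hb, ha⟩ := hl
    set u := s.map (Equiv.swap a b).toEmbedding with hu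
    have hur : u.card = r := by simp [hu, hs]
    have huc : uᶜ.card = m := by rw [← hsc, Finset.card_compl, Finset.card_compl, hur, hs]
    have hsum : ∑ i ∈ u, (i : ℕ) + 1 = k := by
      rw [hu, Finset.sum_map, ← hk, ← Finset.add_sum_erase _ _ hb, ← Finset.add_sum_erase _ _ hb]
      have h : ∀ x ∈ s.erase b, ((Equiv.swap a b).toEmbedding x : ℕ) = x := by
        intro x hx
        rw [Equiv.coe_toEmbedding, Equiv.swap_apply_of_ne_of_ne]
        · rintro rfl
          simp_all
        · exact Finset.ne_of_mem_erase hx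
      rw [Finset.sum_congr rfl h]
      simp only [Equiv.coe_toEmbedding, Equiv.swap_apply_right, hab]
      ring
    obtain ⟨t, ht, htc, htl, hsign⟩ := ih _ (by omega) u hur huc rfl
    refine ⟨t, ht, htc, htl, ?_⟩
    have he : (finSumEquivOfFinset hs hsc).symm.trans (finSumEquivOfFinset ht htc) =
        (Equiv.swap a b).trans
          ((finSumEquivOfFinset hur huc).symm.trans (finSumEquivOfFinset ht htc)) := by
      rw [finSumEquivOfFinset_map_swap hab ha hb hs hsc hur huc]
      ext x
      simp
    have hne : a ≠ b := fun h => ha (h ▸ hb)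
    rw [he, Equiv.Perm.sign_trans, hsign, Equiv.Perm.sign_swap hne, ← hsum,
      add_right_comm, pow_succ]

lemma sign_finSumEquivOfFinset_symm_trans {n r m : ℕ} (s t : Finset (Fin n))
    (hs : s.card = r) (hsc : sᶜ.card = m) (ht : t.card = r) (htc : tᶜ.card = m) :
    Equiv.Perm.sign ((finSumEquivOfFinset hs hsc).symm.trans (finSumEquivOfFinset ht htc)) =
      (-1) ^ ((∑ i ∈ s, (i : ℕ)) + ∑ i ∈ t, (i : ℕ)) := by
  obtain ⟨u, hu, huc, hul, hsu⟩ := exists_isLowerSet_sign_finSumEquivOfFinset s hs hsc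
  obtain ⟨v, hv, hvc, hvl, htv⟩ := exists_isLowerSet_sign_finSumEquivOfFinset t ht htc
  obtain rfl : u = v := by
    rcases hul.total hvl with h | h
    · exact Finset.eq_of_subset_of_card_le (by exact_mod_cast h) (by omega)
    · exact (Finset.eq_of_subset_of_card_le (by exact_mod_cast h) (by omega)).symm
  have he : (finSumEquivOfFinset hs hsc).symm.trans (finSumEquivOfFinset ht htc) =
      ((finSumEquivOfFinset hs hsc).symm.trans (finSumEquivOfFinset hu huc)).trans
        ((finSumEquivOfFinset ht htc).symm.trans (finSumEquivOfFinset hv hvc)).symm := by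
    ext x
    simp
  rw [he, Equiv.Perm.sign_trans, Equiv.Perm.sign_symm, hsu, htv, ← pow_add,
    show ∀ x y z : ℕ, y + z + (x + z) = x + y + 2 * z by intros; ring, pow_add _ _ (2 * _)]
  simp

/-- Complementary minors of mutually inverse block matrices. -/
lemma det_toBlocks₁₁_eq_det_mul_det_toBlocks₂₂ {R m n : Type*} [CommRing R] [Fintype m]
    [Fintype n] [DecidableEq m] [DecidableEq n] {M N : Matrix (m ⊕ n) (m ⊕ n) R}
    (h : M * N = 1) : M.toBlocks₁₁.det = M.det * N.toBlocks₂₂.det := by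
  have key : M * fromBlocks 1 N.toBlocks₁₂ 0 N.toBlocks₂₂ =
      fromBlocks M.toBlocks₁₁ 0 M.toBlocks₂₁ 1 := by
    rw [← fromBlocks_toBlocks M, ← fromBlocks_toBlocks N, fromBlocks_multiply,
      ← fromBlocks_one, fromBlocks_inj] at h
    conv_lhs => rw [← fromBlocks_toBlocks M]
    rw [fromBlocks_multiply]
    simp [h.2.1, h.2.2.2]
  simpa using (congrArg det key).symm

lemma det_submatrix_equiv_equiv {R m n : Type*} [CommRing R] [Fintype m] [Fintype n]
    [DecidableEq m] [DecidableEq n] (A : Matrix n n R) (e f : m ≃ n) :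
    (A.submatrix e f).det = Equiv.Perm.sign (e.symm.trans f) * A.det := by
  rw [← det_permute' (e.symm.trans f) A, ← det_submatrix_equiv_self e]
  congr 1
  ext i j
  simp



/-- Jacobi's identity on complementary minors: `det(A_{I,J}) = ε · det(A) · det(((Aᵀ)⁻¹)_{Iᶜ,Jᶜ})`
with `ε = (−1)^{Σ_{i∈I} i + Σ_{j∈J} j}`. -/
theorem det_submatrix_eq_sign_mul_det_mul_det_complementary
    {F : Type*} [Field F] {n r : ℕ} (A : Matrix (Fin n) (Fin n) F) (hA : A.det ≠ 0)
    (I J : Finset (Fin n)) (hI : I.card = r) (hJ : J.card = r) :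
    (A.submatrix (I.orderEmbOfFin hI) (J.orderEmbOfFin hJ)).det =
      (-1 : F) ^ ((∑ i ∈ I, (i : ℕ)) + ∑ j ∈ J, (j : ℕ)) * A.det *
        (((Aᵀ)⁻¹).submatrix
          (Iᶜ.orderEmbOfFin (show Iᶜ.card = n - r by simp [Finset.card_compl, hI]))
          (Jᶜ.orderEmbOfFin (show Jᶜ.card = n - r by simp [Finset.card_compl, hJ]))).det := by
  have hIc : Iᶜ.card = n - r := by simp [Finset.card_compl, hI]
  have hJc : Jᶜ.card = n - r := by simp [Finset.card_compl, hJ]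
  let e := finSumEquivOfFinset hI hIc
  let f := finSumEquivOfFinset hJ hJc
  have h : A.submatrix e f * A⁻¹.submatrix f e = 1 := by
    rw [submatrix_mul_equiv, mul_nonsing_inv _ hA.isUnit, submatrix_one_equiv]
  have hdet := det_toBlocks₁₁_eq_det_mul_det_toBlocks₂₂ h
  rw [det_submatrix_equiv_equiv, sign_finSumEquivOfFinset_symm_trans I J,
    ← det_transpose (toBlocks₂₂ _)] at hdet
  rw [← transpose_nonsing_inv]
  push_cast at hdet
  exact hdet
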